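/- arXiv:1101.3642 — 3 statements merged into one kernel-verified Lean document; each statement's English description precedes it below -/
import Mathlib

section
/- Let (R, m) be a local Cohen-Macaulay ring with a canonical module ω_R, and let X be a finitely generated R-module. Then for every prime ideal p of R, dim R - depth_R X ≥ dim R_p - depth_{R_p} X_p. -/
open CategoryTheory IsLocalRing
open scoped Classical

universe u

noncomputable section

/-- The depth of a module over a Noetherian local ring: the supremum of lengths of
regular sequences contained in the maximal ideal (with `depth 0 = ⊤`). -/
def rdepth (R : Type u) [CommRing R] [IsLocalRing R]
    (M : Type u) [AddCommGroup M] [Module R M] : ℕ∞ :=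
  if Subsingleton M then ⊤
  else sSup {n : ℕ∞ | ∃ rs : List R, (∀ r ∈ rs, r ∈ IsLocalRing.maximalIdeal R) ∧
    RingTheory.Sequence.IsRegular M rs ∧ (rs.length : ℕ∞) = n}

/-- Vanishing of `Ext^i` over an arbitrary ring. -/
def extVanish (A : Type u) [Ring A] (i : ℕ) (X Y : ModuleCat.{u} A) : Prop :=
  Subsingleton (((Ext ℤ (ModuleCat.{u} A) i).obj (Opposite.op X)).obj Y)

/-- Projective dimension, via vanishing of Ext. -/
def projDim (A : Type u) [Ring A] (X : Type u) [AddCommGroup X] [Module A X] : ℕ∞ :=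
  sInf {n : ℕ∞ | ∀ i : ℕ, n < (i : ℕ∞) → ∀ Y : ModuleCat.{u} A,
    extVanish A i (ModuleCat.of A X) Y}

/-- Global dimension of a ring, via vanishing of Ext. -/
def globalDim (A : Type u) [Ring A] : ℕ∞ :=
  sInf {n : ℕ∞ | ∀ i : ℕ, n < (i : ℕ∞) → ∀ X Y : ModuleCat.{u} A, extVanish A i X Y}

/-- A Noetherian local ring is Cohen-Macaulay if its depth equals its Krull dimension. -/
def IsCMLocalRing (R : Type u) [CommRing R] [IsLocalRing R] : Prop :=
  (rdepth R R : WithBot ℕ∞) = ringKrullDim R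

/-- A ring is Cohen-Macaulay if all its localizations at primes are Cohen-Macaulay. -/
def IsCMRing (R : Type u) [CommRing R] : Prop :=
  ∀ (p : Ideal R) (hp : p.IsPrime),
    letI := hp
    IsCMLocalRing (Localization.AtPrime p)

/-- A canonical module of a local ring: a maximal Cohen-Macaulay module of finite injective
dimension whose endomorphism ring is `R`. -/
structure IsCanonicalModule (R : Type u) [CommRing R] [IsLocalRing R]
    (w : Type u) [AddCommGroup w] [Module R w] : Prop where
  finite : Module.Finite R w
  mcm : (rdepth R w : WithBot ℕ∞) = ringKrullDim R
  finInjDim : ∃ n : ℕ, ∀ i : ℕ, n < i → ∀ X : ModuleCat.{u} R,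
    extVanish R i X (ModuleCat.of R w)
  endIso : Nonempty (Module.End R w ≃+* R)

/-- A canonical module of a (not necessarily local) ring: a finitely generated module
which localizes to a canonical module at every maximal ideal. -/
def IsGlobalCanonicalModule (R : Type u) [CommRing R]
    (w : Type u) [AddCommGroup w] [Module R w] : Prop :=
  Module.Finite R w ∧
  ∀ (m : Ideal R) (hm : m.IsMaximal),
    letI := hm.isPrime
    IsCanonicalModule (Localization.AtPrime m) (LocalizedModule m.primeCompl w)

/-- The height of a prime ideal. -/
def primeHeight {R : Type u} [CommRing R] (p : Ideal R) (hp : p.IsPrime) : ℕ∞ :=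
  Order.height (⟨p, hp⟩ : PrimeSpectrum R)

/-- All maximal ideals have the same height. -/
def EquiCodimensional (R : Type u) [CommRing R] : Prop :=
  ∀ (m₁ m₂ : Ideal R) (h₁ : m₁.IsMaximal) (h₂ : m₂.IsMaximal),
    primeHeight m₁ h₁.isPrime = primeHeight m₂ h₂.isPrime

/-- A non-singular `R`-order: a module-finite `R`-algebra which is a maximal Cohen-Macaulay
`R`-module and such that `gl.dim Λ_p = dim R_p` for all primes `p` of `R`. -/
structure IsNonsingularOrder (R : Type u) [CommRing R]
    (L : Type u) [Ring L] [Algebra R L] : Prop where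
  finite : Module.Finite R L
  mcm : ∀ (p : Ideal R) (hp : p.IsPrime),
    letI := hp
    (rdepth (Localization.AtPrime p) (LocalizedModule p.primeCompl L) : WithBot ℕ∞)
      = ringKrullDim (Localization.AtPrime p)
  gldim : ∀ (p : Ideal R) (hp : p.IsPrime),
    letI := hp
    (globalDim (LocalizedModule p.primeCompl L) : WithBot ℕ∞)
      = ringKrullDim (Localization.AtPrime p)

/-- `Hom_R(M,N)` is a left module over `End_R(M)^op` via precomposition.
(The paper's convention `fg = f then g` makes its `End_R(M)` the opposite of Mathlib's.) -/
instance endOpModuleHom {R M N : Type u} [CommRing R] [AddCommGroup M] [Module R M]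
    [AddCommGroup N] [Module R N] :
    Module (Module.End R M)ᵐᵒᵖ (M →ₗ[R] N) where
  smul a g := g ∘ₗ a.unop
  one_smul g := LinearMap.ext fun _ => rfl
  mul_smul a b g := LinearMap.ext fun _ => rfl
  smul_zero a := LinearMap.ext fun _ => rfl
  smul_add a g h := LinearMap.ext fun _ => rfl
  add_smul a b g := LinearMap.ext fun x => g.map_add _ _
  zero_smul g := LinearMap.ext fun x => g.map_zero

/-- A noncommutative crepant resolution: `End_R(M)` for a nonzero finitely generated
reflexive `R`-module `M` such that `End_R(M)` is a non-singular `R`-order. -/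
def IsNCCR (R : Type u) [CommRing R] (M : Type u) [AddCommGroup M] [Module R M] : Prop :=
  Nontrivial M ∧ Module.Finite R M ∧ Module.IsReflexive R M ∧
    IsNonsingularOrder R (Module.End R M)ᵐᵒᵖ

/-- `X ∈ add M`: `X` is a direct summand of a finite direct sum of copies of `M`. -/
def InAdd (A : Type u) [Ring A] (M : Type u) [AddCommGroup M] [Module A M]
    (X : Type u) [AddCommGroup X] [Module A X] : Prop :=
  ∃ (n : ℕ) (s : X →ₗ[A] (Fin n → M)) (r : (Fin n → M) →ₗ[A] X),
    r ∘ₗ s = LinearMap.id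

end

/-- If `x` lies in the maximal ideal and is regular on `N`, then the vanishing of
`Ext^{i+1}(N/xN, M)` implies the vanishing of `Ext^i(N, M)`. -/
lemma subsingleton_ext_of_quotSMulTop {R : Type u} [CommRing R] [IsLocalRing R]
    [IsNoetherianRing R] (N M : ModuleCat.{u} R) [Module.Finite R N] [Module.Finite R M]
    {x : R} (hx : x ∈ maximalIdeal R) (reg : IsSMulRegular N x) (i : ℕ)
    (h : Subsingleton (Abelian.Ext (ModuleCat.of R (QuotSMulTop x N)) M (i + 1))) :
    Subsingleton (Abelian.Ext N M i) := by
  have hS : (N.smulShortComplex x).ShortExact := reg.smulShortComplex_shortExact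
  have mk₀_smul_comp (z : Abelian.Ext N M i) :
      (Abelian.Ext.mk₀ (x • 𝟙 N)).comp z (zero_add i) = x • z := by
    rw [Abelian.Ext.mk₀_smul, Abelian.Ext.smul_comp, Abelian.Ext.mk₀_id_comp]
  have surj : ∀ y : Abelian.Ext N M i, ∃ z : Abelian.Ext N M i, x • z = y := by
    intro y
    obtain ⟨z, hz⟩ := Abelian.Ext.contravariant_sequence_exact₁ hS _ y (add_comm 1 i)
      (@Subsingleton.elim _ h _ _)
    exact ⟨z, (mk₀_smul_comp z).symm.trans hz⟩
  by_contra ntr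
  rw [not_subsingleton_iff_nontrivial] at ntr
  refine Submodule.top_ne_pointwise_smul_of_mem_jacobson_annihilator (R := R)
    (M := Abelian.Ext N M i) (IsLocalRing.maximalIdeal_le_jacobson _ hx) (eq_top_iff.mpr ?_).symm
  intro y _
  obtain ⟨z, rfl⟩ := surj y
  exact Submodule.smul_mem_pointwise_smul _ _ ⊤ trivial

/-- Ischebeck's theorem: if `M` admits a regular sequence of length `n` in the maximal ideal, then
`Ext^i(N, M) = 0` whenever `i + dim N < n`. -/
lemma subsingleton_ext_of_add_supportDim_lt {R : Type u} [CommRing R] [IsLocalRing R]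
    [IsNoetherianRing R] (M : ModuleCat.{u} R) [Module.Finite R M] [Nontrivial M]
    (rs : List R) (mem : ∀ a ∈ rs, a ∈ maximalIdeal R)
    (reg : RingTheory.Sequence.IsRegular M rs) (r : ℕ) (N : Type u) [AddCommGroup N] [Module R N]
    [Module.Finite R N] (hN : Module.supportDim R N ≤ r) (i : ℕ) (hi : i + r < rs.length) :
    Subsingleton (Abelian.Ext (ModuleCat.of R N) M i) := by
  induction r using Nat.strong_induction_on generalizing N i with
  | _ r ih =>
  induction ‹Module.Finite R N› using
    IsNoetherianRing.induction_on_isQuotientEquivQuotientPrime R with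
  | subsingleton N =>
    have hz : Limits.IsZero (ModuleCat.of R N) := ModuleCat.isZero_of_subsingleton _
    refine subsingleton_of_forall_eq 0 fun y ↦ ?_
    rw [← Abelian.Ext.mk₀_id_comp y, hz.eq_of_src (𝟙 _) 0, Abelian.Ext.mk₀_zero,
      Abelian.Ext.zero_comp]
  | quotient N q f =>
    have ne : Nontrivial N := f.toEquiv.nontrivial
    by_cases hq : maximalIdeal R ≤ q.asIdeal
    · refine ModuleCat.subsingleton_ext_of_exists_isRegular (maximalIdeal R) _ ?_ M ?_ rs mem reg
        i (by omega)
      · change Module.support R N ⊆ _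
        rw [f.support_eq, Module.support_eq_zeroLocus, Ideal.annihilator_quotient]
        exact PrimeSpectrum.zeroLocus_anti_mono hq
      · exact (Submodule.top_ne_ideal_smul_of_le_jacobson_annihilator
          (IsLocalRing.maximalIdeal_le_jacobson _)).symm.lt_top
    · obtain ⟨x, hx, hxq⟩ := SetLike.not_le_iff_exists.mp hq
      have xreg : IsSMulRegular N x := by
        rw [f.isSMulRegular_congr]
        intro a b hab
        have hab' : x • a = x • b := hab
        rw [Algebra.smul_def, Algebra.smul_def] at hab'
        refine mul_left_cancel₀ ?_ hab'
        rwa [Ne, Ideal.Quotient.algebraMap_eq, Ideal.Quotient.eq_zero_iff_mem]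
      have hdim := Module.supportDim_quotSMulTop_succ_eq_supportDim xreg hx
      have : Nontrivial (QuotSMulTop x N) := nontrivial_quotSMulTop_of_mem_maximalIdeal N hx
      obtain ⟨k, hk⟩ : ∃ k : ℕ, r = k + 1 ∧ Module.supportDim R (QuotSMulTop x N) ≤ k := by
        have hb := Module.supportDim_ne_bot_of_nontrivial R (QuotSMulTop x N)
        rw [← hdim] at hN
        cases r with
        | zero =>
          exfalso
          rw [Nat.cast_zero, ENat.WithBot.add_one_le_zero_iff] at hN
          exact hb hN
        | succ k =>
          refine ⟨k, rfl, ?_⟩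
          rw [Nat.cast_add, Nat.cast_one] at hN
          simpa using (ENat.WithBot.add_le_add_natCast_right_iff (c := 1)).mp (by simpa using hN)
      exact subsingleton_ext_of_quotSMulTop (ModuleCat.of R N) M hx xreg i
        (ih k (by omega) (QuotSMulTop x N) hk.2 (i + 1) (by omega))
  | exact N₁ N₂ N₃ f g hf hg hfg h₁ h₃ =>
    have s₁ := h₁ ((Module.supportDim_le_of_injective f hf).trans hN)
    have s₃ := h₃ ((Module.supportDim_le_of_surjective g hg).trans hN)
    have hS := ModuleCat.shortComplex_shortExact
      (ModuleCat.shortComplexOfCompEqZero f g hfg.linearMap_comp_eq_zero) hfg hf hg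
    refine subsingleton_of_forall_eq 0 fun y ↦ ?_
    obtain ⟨z, hz⟩ := Abelian.Ext.contravariant_sequence_exact₂ hS _ y (@Subsingleton.elim _ s₁ _ _)
    rw [← hz, @Subsingleton.elim _ s₃ z 0, Abelian.Ext.comp_zero]

/-- `ht p + dim R/p ≤ dim R`. -/
lemma height_add_ringKrullDim_quotient_le {R : Type u} [CommRing R] (p : Ideal R)
    [hp : p.IsPrime] : (p.height : WithBot ℕ∞) + ringKrullDim (R ⧸ p) ≤ ringKrullDim R := by
  have : Nonempty (PrimeSpectrum R) := ⟨⟨p, hp⟩⟩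
  have hset : PrimeSpectrum.zeroLocus (p : Set R) = Set.Ici (⟨p, hp⟩ : PrimeSpectrum R) := rfl
  rw [ringKrullDim_quotient, hset, ← Order.coheight_eq_krullDim_Ici,
    PrimeSpectrum.height_eq_orderHeight ⟨p, hp⟩, ringKrullDim, Order.krullDim_eq_iSup_height_add_coheight_of_nonempty,
    ← WithBot.coe_add, WithBot.coe_le_coe]
  exact le_iSup (fun a : PrimeSpectrum R ↦ Order.height a + Order.coheight a) ⟨p, hp⟩

/-- `depth M ≤ depth M_p + dim R/p`. -/
lemma rdepth_le_rdepth_localizedModule_add {R : Type u} [CommRing R] [IsLocalRing R]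
    [IsNoetherianRing R] (X : Type u) [AddCommGroup X] [Module R X] [Module.Finite R X]
    (p : Ideal R) [p.IsPrime] (hX : Nontrivial (LocalizedModule p.primeCompl X)) (r : ℕ)
    (hr : ringKrullDim (R ⧸ p) = r) :
    rdepth R X ≤ rdepth (Localization.AtPrime p) (LocalizedModule p.primeCompl X) + r := by
  have ntr : Nontrivial X := by
    by_contra h
    rw [not_nontrivial_iff_subsingleton] at h
    exact not_subsingleton_iff_nontrivial.mpr hX inferInstance
  rw [rdepth, if_neg (not_subsingleton_iff_nontrivial.mpr ntr), sSup_le_iff]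
  rintro _ ⟨rs, mem, reg, rfl⟩
  rw [← tsub_le_iff_right, rdepth, if_neg (not_subsingleton_iff_nontrivial.mpr hX)]
  have hlt : p • (⊤ : Submodule R (ModuleCat.of R X)) < ⊤ :=
    (Submodule.top_ne_ideal_smul_of_le_jacobson_annihilator
      ((IsLocalRing.le_maximalIdeal (Ideal.IsPrime.ne_top ‹_›)).trans
        (IsLocalRing.maximalIdeal_le_jacobson _))).symm.lt_top
  have hsupp : Module.support R (ModuleCat.of R (R ⧸ p)) = PrimeSpectrum.zeroLocus p := by
    change Module.support R (R ⧸ p) = _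
    rw [Module.support_eq_zeroLocus, Ideal.annihilator_quotient]
  obtain ⟨ss, hlen, hmem, hreg⟩ := ModuleCat.exists_isRegular_of_exists_subsingleton_ext p
    (rs.length - r) (ModuleCat.of R X) hlt (ModuleCat.of R (R ⧸ p)) hsupp fun i hi ↦
      subsingleton_ext_of_add_supportDim_lt (ModuleCat.of R X) rs mem reg r (R ⧸ p)
        (by rw [Module.supportDim_quotient_eq_ringKrullDim, hr]) i (by omega)
  refine le_sSup ⟨ss.map (algebraMap R (Localization.AtPrime p)), ?_, ?_, ?_⟩
  · simp only [List.mem_map, forall_exists_index, and_imp, forall_apply_eq_imp_iff₂]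
    intro a ha
    exact (IsLocalization.AtPrime.to_map_mem_maximal_iff _ p a).mpr (hmem a ha)
  · exact hreg.1.isRegular_of_isLocalizedModule_of_mem (Localization.AtPrime p) p
      (LocalizedModule.mkLinearMap p.primeCompl X) hmem
  · simp [hlen]

/-- codepth does not decrease under localization. -/
theorem stmt6 (R : Type u) [CommRing R] [IsLocalRing R] [IsNoetherianRing R]
    (hCM : IsCMLocalRing R)
    (w : Type u) [AddCommGroup w] [Module R w] (hw : IsCanonicalModule R w)
    (X : Type u) [AddCommGroup X] [Module R X] [Module.Finite R X]
    (p : Ideal R) (hp : p.IsPrime)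
    (d e : ℕ) (hd : ringKrullDim R = d)
    (he : letI := hp; ringKrullDim (Localization.AtPrime p) = e) :
    letI := hp
    ((e : ℕ∞) - rdepth (Localization.AtPrime p) (LocalizedModule p.primeCompl X))
      ≤ (d : ℕ∞) - rdepth R X := by
  rcases subsingleton_or_nontrivial (LocalizedModule p.primeCompl X) with h | h
  · rw [show rdepth (Localization.AtPrime p) (LocalizedModule p.primeCompl X) = ⊤ from if_pos h]
    simp
  have hsum := height_add_ringKrullDim_quotient_le p
  rw [← IsLocalization.AtPrime.ringKrullDim_eq_height p (Localization.AtPrime p), he, hd] at hsum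
  obtain ⟨r, hr⟩ : ∃ r : ℕ, ringKrullDim (R ⧸ p) = r := by
    have hb : 0 ≤ ringKrullDim (R ⧸ p) := ringKrullDim_nonneg_of_nontrivial
    have hle : ringKrullDim (R ⧸ p) ≤ d := hd ▸ ringKrullDim_quotient_le p
    generalize ringKrullDim (R ⧸ p) = a at *
    induction a with
    | bot => simp at hb
    | coe a =>
      induction a with
      | top => exact absurd (WithBot.coe_le_coe.mp hle) (ENat.natCast_lt_top d).not_ge
      | coe n => exact ⟨n, rfl⟩
  rw [hr] at hsum
  have her : e + r ≤ d := by exact_mod_cast hsum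
  have key := rdepth_le_rdepth_localizedModule_add X p h r hr
  generalize rdepth (Localization.AtPrime p) (LocalizedModule p.primeCompl X) = b at *
  generalize rdepth R X = a at *
  induction b with
  | top => simp
  | coe b =>
    induction a with
    | top => exact absurd key (by exact_mod_cast (ENat.natCast_lt_top (b + r)).not_ge)
    | coe a =>
      have : a ≤ b + r := by exact_mod_cast key
      exact_mod_cast (by omega : e - b ≤ d - a)
end

section
/- Let (R, m) be a local Cohen-Macaulay ring with canonical module, of dimension d ≥ 2, and let Λ be a non-singular R-order. If X is a finitely generated Λ-module whose underlying R-module is reflexive in the sense that depth_R X ≥ 2 holds, then proj.dim_Λ X ≤ d - 2. -/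
open CategoryTheory IsLocalRing
open scoped Classical

universe u

section

open Abelian ModuleCat.Algebra

/-- Both models of `Ext` in positive degree compute the cohomology of `Hom(P, Y)` for a projective
resolution `P`. -/
lemma extVanish_succ_iff (A : Type u) [Ring A] (i : ℕ) (X Y : ModuleCat.{u} A) :
    extVanish A (i + 1) X Y ↔ Subsingleton (Abelian.Ext X Y (i + 1)) := by
  let P := projectiveResolution X
  trans ∀ f : P.complex.X (i + 1) ⟶ Y, P.complex.d (i + 2) (i + 1) ≫ f = 0 →
      ∃ g : P.complex.X i ⟶ Y, P.complex.d (i + 1) i ≫ g = f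
  · rw [extVanish, ← ModuleCat.isZero_iff_subsingleton, (P.isoExt (i + 1) Y).isZero_iff,
      ← HomologicalComplex.exactAt_iff_isZero_homology,
      HomologicalComplex.exactAt_iff' _ i (i + 1) (i + 2) (by simp) (by simp),
      ShortComplex.moduleCat_exact_iff]
    rfl
  · constructor
    · refine fun h ↦ subsingleton_of_forall_eq 0 fun α ↦ ?_
      obtain ⟨f, hf, rfl⟩ := P.extMk_surjective α (i + 2) rfl
      exact (P.extMk_eq_zero_iff f _ rfl hf i rfl).2 (h f hf)
    · intro h f hf
      exact (P.extMk_eq_zero_iff f _ rfl hf i rfl).1 (Subsingleton.elim _ _)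

lemma hasProjectiveDimensionLE_of_globalDim_le {A : Type u} [Ring A] {n : ℕ}
    (h : globalDim A ≤ n) (X : ModuleCat.{u} A) : HasProjectiveDimensionLE X n := by
  have hne : {n : ℕ∞ | ∀ i : ℕ, n < (i : ℕ∞) → ∀ X Y : ModuleCat.{u} A,
      extVanish A i X Y}.Nonempty := ⟨⊤, fun i hi ↦ by simp at hi⟩
  have hmem := csInf_mem hne
  refine (hasProjectiveDimensionLT_iff X (n + 1)).2 fun i hi Y e ↦ ?_
  obtain _ | i := i
  · simp at hi
  · have := (extVanish_succ_iff A i X Y).1 (hmem _ (h.trans_lt (by exact_mod_cast hi)) X Y)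
    exact Subsingleton.elim _ _

lemma projDim_le_of_hasProjectiveDimensionLE {A : Type u} [Ring A] {n : ℕ}
    (X : Type u) [AddCommGroup X] [Module A X]
    (h : HasProjectiveDimensionLE (ModuleCat.of A X) n) : projDim A X ≤ n := by
  refine sInf_le fun i hi Y ↦ ?_
  obtain _ | i := i
  · simp at hi
  · exact (extVanish_succ_iff A i _ Y).2
      (HasProjectiveDimensionLT.subsingleton _ (n + 1) _ (by exact_mod_cast hi) Y)

attribute [local instance] RingHomInvPair.of_ringEquiv in
lemma hasProjectiveDimensionLE_of_ringEquiv {A B : Type u} [Ring A] [Ring B] (e : A ≃+* B) {n : ℕ}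
    (h : ∀ X : ModuleCat.{u} B, HasProjectiveDimensionLE X n) (X : ModuleCat.{u} A) :
    HasProjectiveDimensionLE X n := by
  let N : ModuleCat.{u} B := (ModuleCat.restrictScalars e.symm.toRingHom).obj X
  have := h N
  exact ModuleCat.hasProjectiveDimensionLE_of_semiLinearEquiv e.symm (M := N) (N := X)
    { AddEquiv.refl X with map_smul' := fun _ _ ↦ rfl } n

/-- Localizing at a submonoid of units does not change an algebra. -/
noncomputable def ringEquivLocalizedModule {R : Type u} [CommRing R] (S : Submonoid R)
    (hS : ∀ s ∈ S, IsUnit s) (A : Type u) [Ring A] [Algebra R A] :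
    A ≃+* LocalizedModule S A :=
  RingEquiv.ofBijective (LocalizedModule.numeratorRingHom : A →+* LocalizedModule S A) <| by
    constructor
    · intro a b h
      obtain ⟨s, hs⟩ := LocalizedModule.mk_eq.1 h
      simp only [one_smul] at hs
      exact (hS s s.2).smul_left_cancel.1 hs
    · intro x
      induction x using LocalizedModule.induction_on with
      | h a s =>
        obtain ⟨u, hu⟩ := hS s s.2
        refine ⟨(↑u⁻¹ : R) • a, LocalizedModule.mk_eq.2 ⟨1, ?_⟩⟩
        simp only [one_smul, Submonoid.smul_def, ← hu, smul_smul, Units.mul_inv]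

lemma IsNonsingularOrder.hasProjectiveDimensionLE {R : Type u} [CommRing R] [IsLocalRing R]
    {d : ℕ} (hd : ringKrullDim R = d) {L : Type u} [Ring L] [Algebra R L]
    (hL : IsNonsingularOrder R L) (X : ModuleCat.{u} L) : HasProjectiveDimensionLE X d := by
  have hunit : ∀ s ∈ (maximalIdeal R).primeCompl, IsUnit s := fun s hs ↦ by
    simpa [Ideal.primeCompl] using hs
  have hg := hL.gldim (maximalIdeal R) inferInstance
  rw [← ringKrullDim_eq_of_ringEquiv
    (IsLocalization.atUnits R (maximalIdeal R).primeCompl hunit).toRingEquiv, hd] at hg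
  exact hasProjectiveDimensionLE_of_ringEquiv (ringEquivLocalizedModule _ hunit L)
    (hasProjectiveDimensionLE_of_globalDim_le (by exact_mod_cast hg.le)) X

section ModuleFinite

variable {R : Type u} [CommRing R] [IsNoetherianRing R] {L : Type u} [Ring L] [Algebra R L]
  [Module.Finite R L]

lemma finite_hom_of_moduleFinite (M N : ModuleCat.{u} L) [Module.Finite L M] [Module.Finite L N] :
    Module.Finite R (M ⟶ N) := by
  have : Module.Finite R M := Module.Finite.trans L M
  have : Module.Finite R N := Module.Finite.trans L N
  let φ : (M ⟶ N) →ₗ[R] (M →ₗ[R] N) :=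
    { toFun := fun f ↦ f.hom.restrictScalars R
      map_add' := fun _ _ ↦ rfl
      map_smul' := fun _ _ ↦ rfl }
  refine Module.Finite.of_injective φ fun f g h ↦ ?_
  ext x
  exact LinearMap.congr_fun h x

lemma finite_ext_of_moduleFinite (M N : ModuleCat.{u} L) [Module.Finite L M] [Module.Finite L N]
    (i : ℕ) : Module.Finite R (Abelian.Ext M N i) := by
  have : IsNoetherianRing L := IsNoetherianRing.of_finite R L
  induction i generalizing M with
  | zero =>
    have := finite_hom_of_moduleFinite (R := R) M N
    exact Module.Finite.equiv (Ext.linearEquiv₀ (R := R)).symm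
  | succ n ih =>
    obtain ⟨k, f, surjf⟩ := Module.Finite.exists_fin' L M
    let exac := LinearMap.shortExact_shortComplexKer surjf
    have := ih f.shortComplexKer.X₁
    exact Module.Finite.of_surjective (exac.extClass.precompOfLinear R N (add_comm 1 n))
      (precomp_extClass_surjective_of_projective_X₂ N exac n)

end ModuleFinite

/-- Over a Noetherian ring, the projective dimension of a finitely generated module is detected by
`Ext` into finitely generated modules. -/
lemma hasProjectiveDimensionLT_of_forall_finite {A : Type u} [Ring A] [IsNoetherianRing A]
    (M : ModuleCat.{u} A) [Module.Finite A M] (n : ℕ)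
    (h : ∀ N : ModuleCat.{u} A, Module.Finite A N → Subsingleton (Abelian.Ext M N (n + 1))) :
    HasProjectiveDimensionLT M (n + 1) := by
  induction n generalizing M with
  | zero =>
    obtain ⟨k, f, surjf⟩ := Module.Finite.exists_fin' A M
    let S : ShortComplex (ModuleCat.{u} A) := f.shortComplexKer
    have hS : S.ShortExact := LinearMap.shortExact_shortComplexKer surjf
    rw [zero_add, ← projective_iff_hasProjectiveDimensionLT_one]
    have : Subsingleton (Abelian.Ext M S.X₁ 1) := h S.X₁ inferInstance
    obtain ⟨f', hf'⟩ := Ext.covariant_sequence_exact₃ M hS (Ext.mk₀ (𝟙 M)) (zero_add 1)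
      (Subsingleton.eq_zero _)
    obtain ⟨f, rfl⟩ := (Ext.mk₀_bijective M S.X₂).2 f'
    rw [Ext.mk₀_comp_mk₀, (Ext.mk₀_bijective _ _).1.eq_iff] at hf'
    exact (Retract.mk f S.g hf').projective
  | succ n ih =>
    obtain ⟨k, f, surjf⟩ := Module.Finite.exists_fin' A M
    let S : ShortComplex (ModuleCat.{u} A) := f.shortComplexKer
    have hS : S.ShortExact := LinearMap.shortExact_shortComplexKer surjf
    rw [hS.hasProjectiveDimensionLT_X₃_iff n inferInstance]
    refine ih S.X₁ fun N hN ↦ subsingleton_of_forall_eq 0 fun e ↦ ?_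
    have := h N hN
    obtain ⟨e', rfl⟩ := Ext.contravariant_sequence_exact₁ hS N e (add_comm 1 (n + 1))
      (Subsingleton.elim (α := Abelian.Ext M N (n + 1 + 1)) _ _)
    rw [e'.eq_zero_of_projective, Ext.comp_zero]

/-- If `x` in the maximal ideal acts injectively on `M`, the projective dimension of `M` is less
than that of `M / x M`. -/
lemma hasProjectiveDimensionLT_of_shortExact_smul {R : Type u} [CommRing R] [IsLocalRing R]
    [IsNoetherianRing R] {L : Type u} [Ring L] [Algebra R L] [Module.Finite R L]
    {M Q : ModuleCat.{u} L} [Module.Finite L M] {x : R} (hx : x ∈ maximalIdeal R)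
    (g : M ⟶ Q) (w : (x • 𝟙 M) ≫ g = 0) (hS : (ShortComplex.mk (x • 𝟙 M) g w).ShortExact) (n : ℕ)
    (hQ : HasProjectiveDimensionLT Q (n + 2)) : HasProjectiveDimensionLT M (n + 1) := by
  have : IsNoetherianRing L := IsNoetherianRing.of_finite R L
  refine hasProjectiveDimensionLT_of_forall_finite M n fun N _ ↦ ?_
  have := finite_ext_of_moduleFinite (R := R) M N (n + 1)
  by_contra! ntr
  refine Submodule.top_ne_pointwise_smul_of_mem_jacobson_annihilator
    (R := R) (M := Abelian.Ext M N (n + 1))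
    (IsLocalRing.maximalIdeal_le_jacobson _ hx) (top_le_iff.1 fun e _ ↦ ?_).symm
  have : Subsingleton (Abelian.Ext Q N (n + 2)) :=
    HasProjectiveDimensionLT.subsingleton Q (n + 2) _ le_rfl N
  obtain ⟨e', rfl⟩ := Ext.contravariant_sequence_exact₁ hS N e (add_comm 1 (n + 1))
    (Subsingleton.elim (α := Abelian.Ext Q N (n + 2)) _ _)
  rw [Ext.mk₀_smul, Ext.smul_comp, Ext.mk₀_id_comp]
  exact Submodule.smul_mem_pointwise_smul _ _ ⊤ trivial

/-- Multiplication by a scalar of the base ring, as an endomorphism over an algebra. -/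
abbrev smulEnd {R : Type u} [CommRing R] (L : Type u) [Ring L] [Algebra R L]
    (X : Type u) [AddCommGroup X] [Module L X] (x : R) : X →ₗ[L] X where
  toFun y := algebraMap R L x • y
  map_add' := smul_add _
  map_smul' l y := by simp only [RingHom.id_apply, smul_smul, Algebra.commutes]

lemma hasProjectiveDimensionLT_of_quotient_range_smulEnd {R : Type u} [CommRing R] [IsLocalRing R]
    [IsNoetherianRing R] {L : Type u} [Ring L] [Algebra R L] [Module.Finite R L]
    (X : Type u) [AddCommGroup X] [Module L X] [Module.Finite L X]
    {x : R} (hx : x ∈ maximalIdeal R) (hinj : Function.Injective (smulEnd L X x)) (n : ℕ)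
    (hQ : HasProjectiveDimensionLT
      (ModuleCat.of L (X ⧸ LinearMap.range (smulEnd L X x))) (n + 2)) :
    HasProjectiveDimensionLT (ModuleCat.of L X) (n + 1) := by
  have hsmul : x • 𝟙 (ModuleCat.of L X) = ModuleCat.ofHom (smulEnd L X x) := rfl
  refine hasProjectiveDimensionLT_of_shortExact_smul hx
    (ModuleCat.ofHom (LinearMap.range (smulEnd L X x)).mkQ) ?_ ?_ n hQ
  · rw [hsmul, ← ModuleCat.ofHom_comp, LinearMap.range_mkQ_comp]
    rfl
  · refine ShortComplex.ShortExact.mk' ?_ ?_ ?_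
    · rw [ShortComplex.moduleCat_exact_iff_range_eq_ker]
      exact (Submodule.ker_mkQ _).symm
    · exact (ModuleCat.mono_iff_injective _).2 hinj
    · exact (ModuleCat.epi_iff_surjective _).2 (Submodule.mkQ_surjective _)

end

/-- modules of depth at least two over a non-singular order. -/
theorem stmt9 (R : Type u) [CommRing R] [IsLocalRing R] [IsNoetherianRing R]
    (hCM : IsCMLocalRing R) (d : ℕ) (hd : ringKrullDim R = d) (hd2 : 2 ≤ d)
    (w : Type u) [AddCommGroup w] [Module R w] (hw : IsCanonicalModule R w)
    (L : Type u) [Ring L] [Algebra R L] (hL : IsNonsingularOrder R L)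
    (X : Type u) [AddCommGroup X] [Module L X] [Module R X] [IsScalarTower R L X]
    [Module.Finite L X] [Nontrivial X]
    (hX : 2 ≤ rdepth R X) :
    projDim L X ≤ ((d - 2 : ℕ) : ℕ∞) := by
  have := hL.finite
  obtain ⟨e, rfl⟩ := Nat.exists_eq_add_of_le' hd2
  rw [Nat.add_sub_cancel]
  rw [rdepth, if_neg (not_subsingleton X)] at hX
  obtain ⟨_, ⟨rs, hmem, hreg, rfl⟩, hlt⟩ :=
    lt_sSup_iff.1 (lt_of_lt_of_le (by norm_num : (1 : ℕ∞) < 2) hX)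
  obtain _ | ⟨x, _ | ⟨y, rs⟩⟩ := rs
  · simp at hlt
  · simp at hlt
  have hw := hreg.toIsWeaklyRegular
  rw [RingTheory.Sequence.isWeaklyRegular_cons_iff,
    RingTheory.Sequence.isWeaklyRegular_cons_iff] at hw
  obtain ⟨hx, hy, -⟩ := hw
  have hsmul (r : R) (z : X) : smulEnd L X r z = r • z := algebraMap_smul L r z
  have hle := hL.hasProjectiveDimensionLE hd
  apply projDim_le_of_hasProjectiveDimensionLE
  refine hasProjectiveDimensionLT_of_quotient_range_smulEnd X (hmem x (by simp)) ?_ e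
    (hasProjectiveDimensionLT_of_quotient_range_smulEnd _ (hmem y (by simp)) ?_ (e + 1) (hle _))
  · intro a b hab
    rw [hsmul, hsmul] at hab
    exact hx hab
  · refine (injective_iff_map_eq_zero _).2 fun q hq ↦ ?_
    obtain ⟨z, rfl⟩ := Submodule.Quotient.mk_surjective _ q
    obtain ⟨t, ht⟩ := (Submodule.Quotient.mk_eq_zero _).1 hq
    have ht' : x • t = y • z := by rw [← hsmul, ht]; exact hsmul y z
    have hz : y • (Submodule.Quotient.mk z : QuotSMulTop x X) = 0 := by
      rw [← Submodule.Quotient.mk_smul, Submodule.Quotient.mk_eq_zero, ← ht']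
      exact Submodule.smul_mem_pointwise_smul _ _ ⊤ trivial
    have hz' := hy.right_eq_zero_of_smul hz
    rw [Submodule.Quotient.mk_eq_zero, Submodule.mem_smul_pointwise_iff_exists] at hz'
    obtain ⟨s, -, rfl⟩ := hz'
    exact (Submodule.Quotient.mk_eq_zero _).2 ⟨s, hsmul x s⟩
end

section
/- Let R be a 2-dimensional Cohen-Macaulay equi-codimensional normal domain with a canonical module. If End_R(M) and End_R(N) are both noncommutative crepant resolutions of R, then End_R(M) and End_R(N) are Morita equivalent, via the progenerator Hom_R(M, N). -/
open CategoryTheory IsLocalRing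
open scoped Classical

universe u

section HomologicalAlgebra

open Limits

variable {C : Type*} [Category C] [Abelian C]

lemma ShortComplex.Exact.shortExact_cokernel {S : ShortComplex C} (hS : S.Exact) :
    (ShortComplex.mk (cokernel.desc S.f S.g S.zero) (cokernel.π S.g)
      (by ext; simp)).ShortExact := by
  have := S.exact_iff_mono_cokernel_desc.1 hS
  refine ShortComplex.ShortExact.mk' ?_ this inferInstance
  let φ : ShortComplex.mk S.g (cokernel.π S.g) (cokernel.condition _) ⟶
      ShortComplex.mk (cokernel.desc S.f S.g S.zero) (cokernel.π S.g) (by ext; simp) :=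
    { τ₁ := cokernel.π _, τ₂ := 𝟙 _, τ₃ := 𝟙 _ }
  have : Epi φ.τ₁ := by dsimp [φ]; infer_instance
  rw [← ShortComplex.exact_iff_of_epi_of_isIso_of_mono φ]
  exact ShortComplex.exact_cokernel S.g

namespace CategoryTheory.ProjectiveResolution

variable {X : C} (P : ProjectiveResolution X)

lemma hasProjectiveDimensionLT_cokernel (n : ℕ) :
    ∀ k : ℕ, Projective (cokernel (P.complex.d (n + 1) n)) → k ≤ n →
      HasProjectiveDimensionLT (cokernel (P.complex.d (k + 1) k)) (n - k + 1) := by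
  intro k h hk
  induction hk using Nat.decreasingInduction with
  | self => simpa [Nat.sub_self] using projective_iff_hasProjectiveDimensionLT_one.1 h
  | of_succ k hk ih =>
    have hS := ShortComplex.Exact.shortExact_cokernel (P.exact_succ k)
    have := hS.hasProjectiveDimensionLT_X₃ (n - (k + 1) + 1) ih
      (hasProjectiveDimensionLT_of_ge _ 1 _ (by lia))
    rwa [show n - (k + 1) + 1 + 1 = n - k + 1 by lia] at this

lemma hasProjectiveDimensionLT (n : ℕ) (h : Projective (cokernel (P.complex.d (n + 1) n))) :
    HasProjectiveDimensionLT X (n + 1) :=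
  have : HasProjectiveDimensionLT
      (CokernelCofork.ofπ _ (cokernel.condition (P.complex.d 1 0))).pt (n + 1) :=
    P.hasProjectiveDimensionLT_cokernel n 0 h (Nat.zero_le n)
  hasProjectiveDimensionLT_of_iso
    ((cokernelIsCokernel (P.complex.d 1 0)).coconePointUniqueUpToIso P.isColimitCokernelCofork)
    (n + 1)

end CategoryTheory.ProjectiveResolution

lemma hasProjectiveDimensionLT_of_isZero_ext {K : Type*} [Ring K] [Linear K C]
    [EnoughProjectives C] (X : C) (n : ℕ)
    (h : ∀ Y : C, IsZero (((Ext K C (n + 1)).obj (Opposite.op X)).obj Y)) :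
    HasProjectiveDimensionLT X (n + 1) := by
  let P := projectiveResolution X
  refine P.hasProjectiveDimensionLT n ?_
  let Z := cokernel (P.complex.d (n + 2) (n + 1))
  have hS := ShortComplex.Exact.shortExact_cokernel (P.exact_succ n)
  have hz := (h Z).of_iso (P.isoExt (R := K) (n + 1) Z).symm
  rw [← HomologicalComplex.exactAt_iff_isZero_homology,
    HomologicalComplex.exactAt_iff' _ n (n + 1) (n + 2) (by simp) (by simp)] at hz
  rw [ShortComplex.moduleCat_exact_iff] at hz
  obtain ⟨r, hr⟩ : ∃ r : P.complex.X n ⟶ Z, P.complex.d (n + 1) n ≫ r = cokernel.π _ :=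
    hz (cokernel.π (P.complex.d (n + 2) (n + 1))) (cokernel.condition _)
  have s : _ := ShortComplex.Splitting.ofExactOfRetraction _ hS.exact r
    (by
      dsimp
      rw [← cancel_epi (cokernel.π _)]
      simpa using hr) hS.epi_g
  exact (Retract.mk s.s (cokernel.π (P.complex.d (n + 1) n)) s.s_g).projective

lemma Module.projective_ker_of_globalDim_le_two {A : Type u} [Ring A] (hA : globalDim A ≤ 2)
    {P Q : Type u} [AddCommGroup P] [Module A P] [Module.Projective A P]
    [AddCommGroup Q] [Module A Q] [Module.Projective A Q] (d : P →ₗ[A] Q) :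
    Module.Projective A (LinearMap.ker d) := by
  obtain ⟨n, hn, hn2⟩ : ∃ n ∈ {n : ℕ∞ | ∀ i : ℕ, n < (i : ℕ∞) →
      ∀ X Y : ModuleCat.{u} A, extVanish A i X Y}, n < 3 :=
    sInf_lt_iff.1 (lt_of_le_of_lt hA (by norm_num))
  have hX (X : ModuleCat.{u} A) : HasProjectiveDimensionLT X 3 :=
    hasProjectiveDimensionLT_of_isZero_ext (K := ℤ) X 2 fun Y =>
      have : Subsingleton (((Ext ℤ (ModuleCat.{u} A) 3).obj (Opposite.op X)).obj Y) :=
        hn 3 hn2 X Y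
      ModuleCat.isZero_of_subsingleton _
  let S : ShortComplex (ModuleCat.{u} A) := ShortComplex.mk
    (ModuleCat.ofHom (LinearMap.ker d).subtype) (ModuleCat.ofHom d.rangeRestrict)
    (ModuleCat.hom_ext (LinearMap.ext fun x => Subtype.ext x.2))
  let T : ShortComplex (ModuleCat.{u} A) := ShortComplex.mk
    (ModuleCat.ofHom (LinearMap.range d).subtype) (ModuleCat.ofHom (LinearMap.range d).mkQ)
    (by ext x; simp)
  have hS : S.ShortExact := ModuleCat.shortComplex_shortExact S
    (fun x => ⟨fun h => ⟨⟨x, congrArg Subtype.val h⟩, rfl⟩,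
      by rintro ⟨y, rfl⟩; exact Subtype.ext y.2⟩)
    Subtype.val_injective d.surjective_rangeRestrict
  have hT : T.ShortExact := ModuleCat.shortComplex_shortExact T
    (fun x => ⟨fun h => ⟨⟨x, (Submodule.Quotient.mk_eq_zero _).1 h⟩, rfl⟩,
      by rintro ⟨y, rfl⟩; exact (Submodule.Quotient.mk_eq_zero _).2 y.2⟩)
    Subtype.val_injective (Submodule.mkQ_surjective _)
  have h2 := hT.hasProjectiveDimensionLT_X₁ 2
    (hasProjectiveDimensionLT_of_ge (ModuleCat.of A Q) 1 2 (by lia)) (hX _)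
  have h1 := hS.hasProjectiveDimensionLT_X₁ 1
    (inferInstanceAs (HasProjectiveDimensionLT (ModuleCat.of A P) 1)) h2
  have := projective_iff_hasProjectiveDimensionLT_one.2 h1
  exact (IsProjective.iff_projective _).2 this

end HomologicalAlgebra

section Localization

variable {R L L' : Type*} [CommRing R] [Ring L] [Algebra R L] [Ring L'] [Algebra R L']
  (S : Submonoid R) (f : L →ₐ[R] L') [IsLocalizedModule S f.toLinearMap]

lemma exists_smul_eq_map_comp {ι : Type*} [Finite ι] (v : ι → L') :
    ∃ s : S, ∃ w : ι → L, (s : R) • v = f ∘ w := by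
  have := IsLocalizedModule.surj S
    (LinearMap.pi fun i : ι => f.toLinearMap ∘ₗ LinearMap.proj (R := R) (φ := fun _ => L) i) v
  obtain ⟨⟨w, s⟩, h⟩ := this
  exact ⟨s, w, h⟩

lemma exists_smul_eq_of_map_comp_eq {ι : Type*} [Finite ι] {v w : ι → L} (h : f ∘ v = f ∘ w) :
    ∃ s : S, (s : R) • v = (s : R) • w :=
  IsLocalizedModule.exists_of_eq (S := S)
    (f := LinearMap.pi fun i : ι => f.toLinearMap ∘ₗ LinearMap.proj (R := R) (φ := fun _ => L) i) h

lemma map_comp_vecMul {n k : Type*} [Fintype n] (D : Matrix n k L) (v : n → L) :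
    f ∘ (Matrix.vecMul v D) = Matrix.vecMul (f ∘ v) (D.map f) :=
  funext fun i => RingHom.map_vecMul f.toRingHom D v i

/-- If the kernel of a matrix becomes projective after localizing, then a surjection from a
finite free module onto the kernel splits up to multiplication by some element of `S`. -/
lemma exists_section_up_to_smul {n k m : Type*} [Fintype n] [Fintype k] [Fintype m]
    (D : Matrix n k L) (hD : Module.Projective L' (LinearMap.ker (D.map f).vecMulLinear))
    (π : (m → L) →ₗ[L] LinearMap.ker D.vecMulLinear) (hπ : Function.Surjective π)
    (hK : (LinearMap.ker π).FG) :
    ∃ r ∈ S, ∃ s : LinearMap.ker D.vecMulLinear →ₗ[L] (m → L), π ∘ₗ s = r • LinearMap.id := by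
  classical
  let x (j : m) : LinearMap.ker D.vecMulLinear := π (Pi.single j 1)
  have hπx (c : m → L) : π c = ∑ j, c j • x j := by
    conv_lhs => rw [← Finset.univ_sum_single c]
    rw [map_sum]
    refine Finset.sum_congr rfl fun j _ => ?_
    rw [← map_smul, ← Pi.single_smul, smul_eq_mul, mul_one]
  have hfx (y : LinearMap.ker D.vecMulLinear) :
      f ∘ (y : n → L) ∈ LinearMap.ker (D.map f).vecMulLinear := by
    have : Matrix.vecMul (y : n → L) D = 0 := y.2
    rw [LinearMap.mem_ker, Matrix.vecMulLinear_apply, ← map_comp_vecMul, this]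
    ext; simp
  let F (y : LinearMap.ker D.vecMulLinear) : LinearMap.ker (D.map f).vecMulLinear :=
    ⟨f ∘ (y : n → L), hfx y⟩
  have hFsum (c : m → L) : F (∑ j, c j • x j) = ∑ j, f (c j) • F (x j) := by
    ext i
    simp [F]
  have hFsmul (r : R) (y) : F (r • y) = algebraMap R L' r • F y := by
    ext i
    simp [F, Algebra.smul_def]
  have hFinj {y z} (h : F y = F z) : ∃ s : S, (s : R) • y = (s : R) • z := by
    obtain ⟨s, hs⟩ := exists_smul_eq_of_map_comp_eq S f (congrArg Subtype.val h)
    exact ⟨s, Subtype.ext hs⟩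
  let π' := Fintype.linearCombination L' fun j => F (x j)
  have hπ'f (c : m → L) : π' (f ∘ c) = F (π c) := by
    rw [hπx, hFsum, Fintype.linearCombination_apply]
    rfl
  have hunit (s : S) : ∃ b : L', b * algebraMap R L' s = 1 := by
    obtain ⟨⟨a, t⟩, h⟩ := IsLocalizedModule.surj S f.toLinearMap (1 : L')
    have hs := IsLocalizedModule.map_units f.toLinearMap s
    obtain ⟨b, hb⟩ := ((Module.End.isUnit_iff _).1 hs).2 1
    refine ⟨b, ?_⟩
    rw [← Algebra.commutes, ← Algebra.smul_def]
    exact hb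
  have hπ' : Function.Surjective π' := by
    intro y
    obtain ⟨s, a, ha⟩ := exists_smul_eq_map_comp S f (y : n → L')
    have h0 : f ∘ (Matrix.vecMul a D) = f ∘ (0 : k → L) := by
      rw [map_comp_vecMul, ← ha, ← algebraMap_smul L' (s : R), Matrix.smul_vecMul]
      have : Matrix.vecMul (y : n → L') (D.map f) = 0 := y.2
      rw [this]
      ext; simp
    obtain ⟨t, ht⟩ := exists_smul_eq_of_map_comp_eq S f h0
    have hta : (t : R) • a ∈ LinearMap.ker D.vecMulLinear := by
      rw [LinearMap.mem_ker, Matrix.vecMulLinear_apply, ← algebraMap_smul L (t : R),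
        Matrix.smul_vecMul, algebraMap_smul, ht, smul_zero]
    obtain ⟨c, hc⟩ := hπ ⟨_, hta⟩
    obtain ⟨b, hb⟩ := hunit (t * s)
    refine ⟨b • (f ∘ c), ?_⟩
    rw [map_smul, hπ'f, hc]
    have : F ⟨_, hta⟩ = algebraMap R L' (t * s : S) • y := by
      ext i
      have := congrFun ha i
      simp only [Function.comp_apply, Pi.smul_apply] at this
      simp [F, ← this, mul_smul, Algebra.smul_def]
    rw [this, smul_smul, hb, one_smul]
  obtain ⟨σ, hσ⟩ := Module.projective_lifting_property π' LinearMap.id hπ'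
  obtain ⟨s, w, hw⟩ := exists_smul_eq_map_comp S f fun p : m × m => σ (F (x p.1)) p.2
  let w' (j i : m) : L := w (j, i)
  have hw' (j : m) : f ∘ w' j = (s : R) • σ (F (x j)) :=
    funext fun i => (congrFun hw (j, i)).symm
  let ψ₀ := Fintype.linearCombination L w'
  have hψ₀ (c : m → L) : f ∘ ψ₀ c = (s : R) • σ (F (π c)) := by
    ext i
    have (j : m) : f (w' j i) = (s : R) • σ (F (x j)) i := congrFun (hw' j) i
    simp [ψ₀, Fintype.linearCombination_apply, hπx, hFsum, this, Finset.smul_sum]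
  obtain ⟨G, hG⟩ := hK
  have hGk (g : G) : (g : m → L) ∈ LinearMap.ker π := hG ▸ Submodule.subset_span g.2
  obtain ⟨u, hu⟩ := exists_smul_eq_of_map_comp_eq S f
    (v := fun p : G × m => ψ₀ p.1 p.2) (w := 0) (by
      ext ⟨g, i⟩
      have := congrFun (hψ₀ g) i
      have hF0 : F 0 = 0 := by ext; simp [F]
      rw [LinearMap.mem_ker.1 (hGk g), hF0] at this
      simpa using this)
  have hker : LinearMap.ker π ≤ LinearMap.ker ((u : R) • ψ₀) := by
    rw [← hG, Submodule.span_le]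
    intro g hg
    ext i
    simpa using congrFun hu (⟨g, hg⟩, i)
  let ψ : LinearMap.ker D.vecMulLinear →ₗ[L] (m → L) :=
    (LinearMap.ker π).liftQ ((u : R) • ψ₀) hker ∘ₗ
      (π.quotKerEquivOfSurjective hπ).symm.toLinearMap
  have hψ (c : m → L) : ψ (π c) = (u : R) • ψ₀ c := by
    have : (π.quotKerEquivOfSurjective hπ).symm (π c) = (LinearMap.ker π).mkQ c := by
      rw [LinearEquiv.symm_apply_eq]
      rfl
    simp only [ψ, LinearMap.comp_apply, LinearEquiv.coe_coe, this]
    rfl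
  have hloc (j : m) : F (π (w' j)) = F ((s : R) • x j) := by
    rw [← hπ'f, hw', hFsmul, ← algebraMap_smul L' (s : R), map_smul]
    congr 1
    exact LinearMap.congr_fun hσ _
  choose t ht using fun j => hFinj (hloc j)
  let T : S := ∏ j, t j
  have hT (j : m) : (T : R) • π (w' j) = (T : R) • (s : R) • x j := by
    obtain ⟨q, hq⟩ := Finset.dvd_prod_of_mem t (Finset.mem_univ j)
    rw [show T = q * t j from hq.trans (mul_comm _ _), Submonoid.coe_mul, mul_smul, mul_smul, ht]
  refine ⟨(u * (T * s) : S), SetLike.coe_mem _, (T : R) • ψ, ?_⟩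
  rw [← LinearMap.cancel_right hπ]
  refine LinearMap.pi_ext' fun j => LinearMap.ext_ring ?_
  have h1 : ψ₀ (Pi.single j 1) = w' j := by
    simp [ψ₀]
  have h2 (r : R) (v : m → L) : π (r • v) = r • π v := by
    rw [← algebraMap_smul L r, map_smul, algebraMap_smul]
  change π ((T : R) • ψ (x j)) = ((u * (T * s) : S) : R) • x j
  rw [hψ, h1, h2, h2, smul_comm, hT]
  simp [mul_smul]

/-- Projectivity of the kernel of a matrix over a module-finite algebra can be deduced from global
dimension bounds at all maximal ideals of the base. -/
lemma projective_ker_vecMulLinear {R L : Type u} [CommRing R] [IsNoetherianRing R] [Ring L]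
    [Algebra R L] [Module.Finite R L]
    (hL : ∀ (m : Ideal R) [m.IsMaximal], globalDim (LocalizedModule m.primeCompl L) ≤ 2)
    {n k : Type} [Fintype n] [Fintype k] (D : Matrix n k L) :
    Module.Projective L (LinearMap.ker D.vecMulLinear) := by
  have : IsNoetherianRing L := isNoetherian_of_tower R inferInstance
  obtain ⟨m, π, hπ⟩ := Module.Finite.exists_fin' L (LinearMap.ker D.vecMulLinear)
  let J : Ideal R :=
    { carrier := {r | ∃ s : LinearMap.ker D.vecMulLinear →ₗ[L] (Fin m → L),
        π ∘ₗ s = r • LinearMap.id}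
      add_mem' := by
        rintro a b ⟨s, hs⟩ ⟨t, ht⟩
        exact ⟨s + t, by rw [LinearMap.comp_add, hs, ht, add_smul]⟩
      zero_mem' := ⟨0, by simp⟩
      smul_mem' := by
        rintro a b ⟨s, hs⟩
        refine ⟨a • s, ?_⟩
        rw [smul_eq_mul, mul_smul, ← hs]
        ext x : 1
        simp only [LinearMap.comp_apply, LinearMap.smul_apply]
        rw [← algebraMap_smul L a, map_smul, algebraMap_smul] }
  have hJ : J = ⊤ := by
    by_contra hne
    obtain ⟨p, hp, hJp⟩ := J.exists_le_maximal hne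
    let f : L →ₐ[R] LocalizedModule p.primeCompl L :=
      { LocalizedModule.numeratorRingHom with commutes' := fun _ => rfl }
    have : IsLocalizedModule p.primeCompl f.toLinearMap :=
      inferInstanceAs (IsLocalizedModule p.primeCompl (LocalizedModule.mkLinearMap p.primeCompl L))
    obtain ⟨r, hr, s, hs⟩ := exists_section_up_to_smul p.primeCompl f D
      (Module.projective_ker_of_globalDim_le_two (hL p) _) π hπ (IsNoetherian.noetherian _)
    exact hr (hJp ⟨s, hs⟩)
  obtain ⟨s, hs⟩ : (1 : R) ∈ J := hJ ▸ Submodule.mem_top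
  exact Module.Projective.of_split s π (by rw [hs, one_smul])

end Localization

lemma Module.IsReflexive.ext_dual (R : Type*) [CommRing R] {M : Type*} [AddCommGroup M]
    [Module R M] [Module.IsReflexive R M] {x y : M} (h : ∀ f : Module.Dual R M, f x = f y) : x = y :=
  (Module.bijective_dual_eval R M).1 (LinearMap.ext h)

lemma Module.IsReflexive.exists_dual_apply_ne_zero (R : Type*) [CommRing R] (M : Type*)
    [AddCommGroup M] [Module R M] [Module.IsReflexive R M] [Nontrivial M] :
    ∃ (x : M) (f : Module.Dual R M), f x ≠ 0 := by
  obtain ⟨x, hx⟩ := exists_ne (0 : M)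
  by_contra! h
  exact hx (Module.IsReflexive.ext_dual R fun f => by rw [h, map_zero])

section Reflexive

variable {R : Type*} [CommRing R] [IsDomain R]

lemma dvd_of_mul_mem_ideal [IsNoetherianRing R] [IsIntegrallyClosed R] {I : Ideal R}
    (hI : I ≠ ⊥) {a b : R} (ha : a ≠ 0) (h : ∀ x ∈ I, ∃ y ∈ I, b * x = a * y) : a ∣ b := by
  have ha' : algebraMap R (FractionRing R) a ≠ 0 := by simpa using ha
  have hint : IsIntegral R (algebraMap R (FractionRing R) b / algebraMap R (FractionRing R) a) := by
    refine isIntegral_of_smul_mem_submodule (Submodule.map (Algebra.linearMap R (FractionRing R)) I) ?_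
      ((IsNoetherian.noetherian I).map _) _ ?_
    · exact fun h0 => hI (Submodule.map_injective_of_injective (f := Algebra.linearMap R (FractionRing R))
        (IsFractionRing.injective R (FractionRing R)) (h0.trans (Submodule.map_bot _).symm))
    · rintro _ ⟨x, hx, rfl⟩
      obtain ⟨y, hy, hxy⟩ := h x hx
      refine ⟨y, hy, ?_⟩
      have := congrArg (algebraMap R (FractionRing R)) hxy
      simp only [map_mul] at this
      simp only [Algebra.linearMap_apply, smul_eq_mul]
      field_simp
      linear_combination -this
  obtain ⟨c, hc⟩ := IsIntegrallyClosed.isIntegral_iff.1 hint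
  refine ⟨c, IsFractionRing.injective R (FractionRing R) ?_⟩
  rw [map_mul, hc, mul_div_cancel₀ _ ha']

lemma exists_linearMap_smul_eq {P Q : Type*} [AddCommGroup P] [Module R P] [AddCommGroup Q]
    [Module R Q] [Module.IsTorsionFree R Q] {a : R} (ha : a ≠ 0) (f : P →ₗ[R] Q)
    (h : ∀ p, ∃ q, f p = a • q) : ∃ g : P →ₗ[R] Q, ∀ p, f p = a • g p := by
  choose g hg using h
  have hinj := smul_right_injective Q ha
  refine ⟨⟨⟨g, fun x y => hinj ?_⟩, fun r x => hinj ?_⟩, hg⟩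
  · simp [← hg, smul_add]
  · change a • g (r • x) = a • r • g x
    rw [← hg, smul_comm, ← hg, map_smul]

variable {M N : Type*} [AddCommGroup M] [Module R M] [AddCommGroup N] [Module R N]

variable [IsNoetherianRing R] [IsIntegrallyClosed R] [Module.IsReflexive R M] [Nontrivial M]

/-- Over a normal domain, a reflexive module `N` is recovered as the `End M`-dual of
`Hom(N, M)`. -/
lemma exists_forall_eq_apply [Module.IsReflexive R N] (φ : (N →ₗ[R] M) →ₗ[R] M)
    (hφ : ∀ (e : Module.End R M) (f : N →ₗ[R] M), φ (e ∘ₗ f) = e (φ f)) :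
    ∃ n : N, ∀ f, φ f = f n := by
  obtain ⟨m, h, hm⟩ := Module.IsReflexive.exists_dual_apply_ne_zero R M
  have key (g : Module.Dual R N) (h' : Module.Dual R M) (m' m'' : M) :
      h' m'' • φ (g.smulRight m') = h' (φ (g.smulRight m'')) • m' := by
    have := hφ (h'.smulRight m') (g.smulRight m'')
    rw [LinearMap.smulRight_apply] at this
    rw [← this, ← map_smul]
    congr 1
    ext n
    simp [smul_smul, mul_comm]
  let b : Module.Dual R N →ₗ[R] R := h ∘ₗ φ ∘ₗ
    { toFun g := g.smulRight m
      map_add' _ _ := by ext; simp [add_smul]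
      map_smul' _ _ := by ext; simp [mul_smul] }
  obtain ⟨c, hc⟩ := exists_linearMap_smul_eq hm b fun g => by
    refine dvd_of_mul_mem_ideal (I := LinearMap.range h) ?_ hm ?_
    · rw [Ne, LinearMap.range_eq_bot]
      rintro rfl
      exact hm rfl
    · rintro _ ⟨m', rfl⟩
      refine ⟨_, ⟨φ (g.smulRight m'), rfl⟩, ?_⟩
      have := congrArg h (key g h m' m)
      simp only [map_smul, smul_eq_mul] at this
      exact this.symm
  obtain ⟨n, rfl⟩ := (Module.bijective_dual_eval R N).2 c
  refine ⟨n, fun f => Module.IsReflexive.ext_dual R fun h' => mul_left_cancel₀ hm ?_⟩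
  have h1 : h (φ ((h' ∘ₗ f).smulRight m)) = h m * h' (f n) := hc (h' ∘ₗ f)
  have h2 : φ ((h' ∘ₗ f).smulRight m) = h' (φ f) • m := hφ (h'.smulRight m) f
  rw [← h1, h2, map_smul, smul_eq_mul, mul_comm]

/-- Over a normal domain, `Hom(M, -)` is full from arbitrary to reflexive modules. -/
lemma exists_forall_eq_comp {M' : Type*} [AddCommGroup M'] [Module R M']
    [Module.IsReflexive R M'] (s : (M →ₗ[R] N) →ₗ[R] (M →ₗ[R] M'))
    (hs : ∀ (f : M →ₗ[R] N) (e : Module.End R M), s (f ∘ₗ e) = s f ∘ₗ e) :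
    ∃ y : N →ₗ[R] M', ∀ f, s f = y ∘ₗ f := by
  obtain ⟨m, h, hm⟩ := Module.IsReflexive.exists_dual_apply_ne_zero R M
  have key (n : N) (h' h'' : Module.Dual R M) (m' m'' : M) :
      h' m'' • s (h''.smulRight n) m' = h'' m' • s (h'.smulRight n) m'' := by
    have := LinearMap.congr_fun (hs (h'.smulRight n) (h''.smulRight m'')) m'
    rw [LinearMap.comp_apply, LinearMap.smulRight_apply, map_smul] at this
    rw [← this, ← LinearMap.smul_apply, ← map_smul]
    congr 2
    ext x
    simp [smul_smul, mul_comm]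
  let b : N →ₗ[R] M' := LinearMap.applyₗ m ∘ₗ s ∘ₗ
    { toFun n := h.smulRight n
      map_add' _ _ := by ext; simp
      map_smul' _ _ := by ext; exact smul_comm _ _ _ }
  have hb (n : N) : b n = s (h.smulRight n) m := rfl
  obtain ⟨y, hy⟩ := exists_linearMap_smul_eq hm b fun n => by
    obtain ⟨c, hc⟩ := exists_linearMap_smul_eq hm (Module.Dual.eval R M' (b n)) fun k => by
      refine dvd_of_mul_mem_ideal (I := LinearMap.range (Module.Dual.eval R M m)) ?_ hm ?_
      · rw [Ne, LinearMap.range_eq_bot]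
        intro h0
        exact hm (LinearMap.congr_fun h0 h)
      · rintro _ ⟨h', rfl⟩
        refine ⟨_, ⟨k ∘ₗ s (h'.smulRight n), rfl⟩, ?_⟩
        have := congrArg k (key n h h' m m)
        simpa [hb, mul_comm] using this.symm
    obtain ⟨q, rfl⟩ := (Module.bijective_dual_eval R M').2 c
    refine ⟨q, Module.IsReflexive.ext_dual R fun k => ?_⟩
    rw [map_smul]
    exact hc k
  refine ⟨y, fun f => LinearMap.ext fun x => smul_right_injective M' hm ?_⟩
  change h m • s f x = h m • y (f x)
  have h1 : s f (h m • x) = s (f ∘ₗ h.smulRight x) m := by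
    rw [hs]; rfl
  rw [← hy, hb, ← map_smul, h1]
  congr 2
  ext; simp

end Reflexive

section EndOp

open MulOpposite

variable {R : Type u} [CommRing R] {M N : Type u} [AddCommGroup M] [Module R M] [AddCommGroup N]
  [Module R N]

lemma endOp_smul_eq_comp (a : (Module.End R M)ᵐᵒᵖ) (x : M →ₗ[R] N) : a • x = x ∘ₗ a.unop := rfl

instance : IsScalarTower R (Module.End R M)ᵐᵒᵖ (M →ₗ[R] N) where
  smul_assoc r a x := by
    ext m
    simp [endOp_smul_eq_comp]

lemma finite_endOp_hom [IsNoetherianRing R] [Module.Finite R M] [Module.Finite R N] :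
    Module.Finite (Module.End R M)ᵐᵒᵖ (M →ₗ[R] N) :=
  Module.Finite.of_restrictScalars_finite R _ _

variable [IsDomain R] [IsNoetherianRing R] [IsIntegrallyClosed R] [Module.Finite R M]
  [Module.Finite R N] [Module.IsReflexive R M] [Module.IsReflexive R N] [Nontrivial M]

lemma exists_endOp_hom_equiv_ker :
    ∃ (n k : ℕ) (D : Matrix (Fin n) (Fin k) (Module.End R M)ᵐᵒᵖ),
      Nonempty ((M →ₗ[R] N) ≃ₗ[(Module.End R M)ᵐᵒᵖ] LinearMap.ker D.vecMulLinear) := by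
  have : IsNoetherian R (N →ₗ[R] M) := isNoetherian_linearMap _ _ _
  have : IsNoetherian R (Module.End R M) := isNoetherian_linearMap _ _ _
  obtain ⟨n, F, hF⟩ := Module.Finite.exists_fin (R := R) (M := N →ₗ[R] M)
  have sep {y : N} (h : ∀ i, F i y = 0) : y = 0 := by
    obtain ⟨m, hm⟩ := exists_ne (0 : M)
    refine Module.IsReflexive.ext_dual R fun g => ?_
    have : ∀ f : N →ₗ[R] M, f y = 0 := fun f => by
      have : (⊤ : Submodule R (N →ₗ[R] M)) ≤ LinearMap.ker (LinearMap.applyₗ y) := by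
        rw [← hF, Submodule.span_le]
        rintro _ ⟨i, rfl⟩
        exact h i
      exact this (Submodule.mem_top (x := f))
    simpa [hm] using this (g.smulRight m)
  let Ψ {P : Type u} [AddCommGroup P] [Module R P] (w : Fin n → (P →ₗ[R] M)) :
      (Fin n → Module.End R M) →ₗ[R] (P →ₗ[R] M) :=
    { toFun c := ∑ i, c i ∘ₗ w i
      map_add' c d := by simp [LinearMap.add_comp, Finset.sum_add_distrib]
      map_smul' r c := by simp [LinearMap.smul_comp, Finset.smul_sum] }
  have hΨ {P : Type u} [AddCommGroup P] [Module R P] (w : Fin n → (P →ₗ[R] M)) (c) :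
      Ψ w c = ∑ i, c i ∘ₗ w i := rfl
  have hsurj : Function.Surjective (Ψ F) := by
    rw [← LinearMap.range_eq_top, eq_top_iff, ← hF, Submodule.span_le]
    rintro _ ⟨i, rfl⟩
    refine ⟨Pi.single i LinearMap.id, ?_⟩
    rw [hΨ, Finset.sum_eq_single i] <;> simp +contextual
  obtain ⟨k, r, hr⟩ := Submodule.fg_iff_exists_fin_generating_family.1
    (IsNoetherian.noetherian (LinearMap.ker (Ψ F)))
  have hker {P : Type u} [AddCommGroup P] [Module R P] (w : Fin n → (P →ₗ[R] M))
      (hw : ∀ j, Ψ w (r j) = 0) : LinearMap.ker (Ψ F) ≤ LinearMap.ker (Ψ w) := by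
    rw [← hr, Submodule.span_le]
    rintro _ ⟨j, rfl⟩
    exact hw j
  have hr0 (j) : Ψ F (r j) = 0 := by
    have : r j ∈ LinearMap.ker (Ψ F) := hr ▸ Submodule.subset_span ⟨j, rfl⟩
    exact this
  let D : Matrix (Fin n) (Fin k) (Module.End R M)ᵐᵒᵖ := .of fun i j => op (r j i)
  have hD (v : Fin n → (Module.End R M)ᵐᵒᵖ) (j) :
      D.vecMulLinear v j = op (Ψ (fun i => (v i).unop) (r j)) := by
    rw [hΨ, Finset.op_sum]
    rfl
  let T : (M →ₗ[R] N) →ₗ[(Module.End R M)ᵐᵒᵖ] (Fin n → (Module.End R M)ᵐᵒᵖ) :=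
    { toFun x i := op (F i ∘ₗ x)
      map_add' x y := funext fun i => congrArg op (LinearMap.comp_add x y (F i))
      map_smul' a x := rfl }
  have hT (x : M →ₗ[R] N) : D.vecMulLinear (T x) = 0 := by
    ext1 j
    rw [hD]
    have : Ψ (fun i => (T x i).unop) (r j) = Ψ F (r j) ∘ₗ x := by
      ext
      simp [hΨ, T]
    rw [this, hr0]
    rfl
  refine ⟨n, k, D, ⟨.ofBijective (T.codRestrict _ hT) ⟨?_, ?_⟩⟩⟩
  · rw [injective_iff_map_eq_zero]
    intro x hx
    ext m
    refine sep fun i => ?_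
    exact LinearMap.congr_fun (op_injective (congrFun (congrArg Subtype.val hx) i)) m
  · rintro ⟨v, hv⟩
    have hv' (j) : Ψ (fun i => (v i).unop) (r j) = 0 := by
      have := congrFun hv j
      rw [hD] at this
      exact op_injective this
    have hex (m : M) : ∃ y : N, ∀ i, F i y = (v i).unop m := by
      have hle : LinearMap.ker (Ψ F) ≤
          LinearMap.ker (LinearMap.applyₗ m ∘ₗ Ψ fun i => (v i).unop) :=
        (hker _ hv').trans (LinearMap.ker_le_ker_comp _ _)
      let φ : (N →ₗ[R] M) →ₗ[R] M :=
        (LinearMap.ker (Ψ F)).liftQ _ hle ∘ₗ ((Ψ F).quotKerEquivOfSurjective hsurj).symm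
      have hφ (c) : φ (Ψ F c) = ∑ i, c i ((v i).unop m) := by
        have : ((Ψ F).quotKerEquivOfSurjective hsurj).symm (Ψ F c) = Submodule.Quotient.mk c := by
          rw [LinearEquiv.symm_apply_eq]
          rfl
        simp only [φ, LinearMap.comp_apply, LinearEquiv.coe_coe, this]
        simp [hΨ]
      obtain ⟨y, hy⟩ := exists_forall_eq_apply φ fun e f => by
        obtain ⟨c, rfl⟩ := hsurj f
        have : e ∘ₗ Ψ F c = Ψ F fun i => e ∘ₗ c i := by
          ext
          simp [hΨ]
        rw [this, hφ, hφ]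
        simp
      refine ⟨y, fun i => ?_⟩
      have : Ψ F (Pi.single i LinearMap.id) = F i := by
        rw [hΨ, Finset.sum_eq_single i] <;> simp +contextual
      rw [← hy, ← this, hφ, Finset.sum_eq_single i] <;> simp +contextual
    choose x hx using hex
    refine ⟨⟨⟨x, fun m m' => ?_⟩, fun a m => ?_⟩, ?_⟩
    · rw [← sub_eq_zero]
      exact sep fun i => by simp [hx]
    · rw [← sub_eq_zero]
      exact sep fun i => by simp [hx]
    · refine Subtype.ext (funext fun i => unop_injective (LinearMap.ext fun m => hx m i))

lemma projective_endOp_hom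
    (hL : ∀ (m : Ideal R) [m.IsMaximal],
      globalDim (LocalizedModule m.primeCompl (Module.End R M)ᵐᵒᵖ) ≤ 2) :
    Module.Projective (Module.End R M)ᵐᵒᵖ (M →ₗ[R] N) := by
  obtain ⟨n, k, D, ⟨e⟩⟩ := exists_endOp_hom_equiv_ker (R := R) (M := M) (N := N)
  have := projective_ker_vecMulLinear hL D
  exact .of_equiv e.symm

/-- If `Hom(M, N)` is projective over `End M`, then `N` is a direct summand of some `M ^ n`. -/
lemma exists_sum_comp_eq_id [Module.Projective (Module.End R M)ᵐᵒᵖ (M →ₗ[R] N)] :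
    ∃ (n : ℕ) (x : Fin n → (M →ₗ[R] N)) (y : Fin n → (N →ₗ[R] M)),
      ∑ i, x i ∘ₗ y i = LinearMap.id := by
  have := finite_endOp_hom (R := R) (M := M) (N := N)
  obtain ⟨n, π, hπ⟩ := Module.Finite.exists_fin' (Module.End R M)ᵐᵒᵖ (M →ₗ[R] N)
  obtain ⟨s, hs⟩ := Module.projective_lifting_property π LinearMap.id hπ
  have hs' (f : M →ₗ[R] N) : ∑ i, s f i • π (Pi.single i 1) = f := by
    conv_rhs => rw [← LinearMap.id_apply (R := (Module.End R M)ᵐᵒᵖ) f, ← hs, LinearMap.comp_apply,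
      LinearMap.pi_apply_eq_sum_univ π]
    refine Finset.sum_congr rfl fun i _ => ?_
    congr 2
    ext1 j
    simp [Pi.single_apply, eq_comm]
  have hex (i : Fin n) : ∃ y : N →ₗ[R] M, ∀ f, (s f i).unop = y ∘ₗ f :=
    exists_forall_eq_comp
      { toFun f := (s f i).unop
        map_add' f g := by simp
        map_smul' r f := by
          have : r • f = (algebraMap R (Module.End R M)ᵐᵒᵖ r) • f := by
            rw [algebraMap_smul]
          rw [this, map_smul]
          ext
          simp } fun f e => by
      change (s (op e • f) i).unop = _
      rw [map_smul]
      rfl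
  choose y hy using hex
  refine ⟨n, fun i => π (Pi.single i 1), y, LinearMap.ext fun z => ?_⟩
  obtain ⟨m, h, hm⟩ := Module.IsReflexive.exists_dual_apply_ne_zero R M
  have := LinearMap.congr_fun (hs' (h.smulRight z)) m
  simp only [LinearMap.sum_apply, endOp_smul_eq_comp, LinearMap.comp_apply, hy,
    LinearMap.smulRight_apply, map_smul, ← Finset.smul_sum] at this
  simpa using smul_right_injective N hm this

end EndOp

section Morita

open MulOpposite

variable {R : Type u} [CommRing R] (M N : Type u) [AddCommGroup M] [Module R M] [AddCommGroup N]
  [Module R N]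

variable {M N} in
/-- Composition with an endomorphism of `N`, as an `(End M)ᵐᵒᵖ`-linear endomorphism of
`Hom(M, N)`. -/
def endOpPostcomp (b : Module.End R N) :
    (M →ₗ[R] N) →ₗ[(Module.End R M)ᵐᵒᵖ] (M →ₗ[R] N) where
  toFun x := b ∘ₗ x
  map_add' x y := LinearMap.comp_add x y b
  map_smul' _ _ := rfl

instance endOpModuleHomHom (U : Type u) [AddCommGroup U] [Module (Module.End R M)ᵐᵒᵖ U] :
    Module (Module.End R N)ᵐᵒᵖ ((M →ₗ[R] N) →ₗ[(Module.End R M)ᵐᵒᵖ] U) where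
  smul b φ := φ ∘ₗ endOpPostcomp b.unop
  one_smul φ := rfl
  mul_smul a b φ := rfl
  smul_zero b := rfl
  smul_add b φ ψ := rfl
  add_smul a b φ := LinearMap.ext fun x =>
    (congrArg φ (LinearMap.add_comp x b.unop a.unop)).trans (map_add φ _ _)
  zero_smul φ := LinearMap.ext fun x => (congrArg φ (LinearMap.zero_comp x)).trans (map_zero φ)

/-- The functor `Hom_{(End M)ᵐᵒᵖ}(Hom(M, N), -)`. -/
def homFunctor : ModuleCat.{u} (Module.End R M)ᵐᵒᵖ ⥤ ModuleCat.{u} (Module.End R N)ᵐᵒᵖ where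
  obj U := ModuleCat.of _ ((M →ₗ[R] N) →ₗ[(Module.End R M)ᵐᵒᵖ] U)
  map f := ModuleCat.ofHom
    { toFun φ := f.hom ∘ₗ φ
      map_add' φ ψ := LinearMap.comp_add φ ψ f.hom
      map_smul' _ _ := rfl }

variable {M N}

/-- The canonical map from `U` to `Hom(Hom(N, M), Hom(Hom(M, N), U))`, which sends `u` to the
pairing `β ↦ α ↦ (β ∘ α) • u`. -/
def homHomUnit (U : Type u) [AddCommGroup U] [Module (Module.End R M)ᵐᵒᵖ U] :
    U →ₗ[(Module.End R M)ᵐᵒᵖ]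
      ((N →ₗ[R] M) →ₗ[(Module.End R N)ᵐᵒᵖ] ((M →ₗ[R] N) →ₗ[(Module.End R M)ᵐᵒᵖ] U)) where
  toFun u :=
    { toFun β :=
        { toFun α := op (β ∘ₗ α) • u
          map_add' α α' := by rw [LinearMap.comp_add, MulOpposite.op_add, add_smul]
          map_smul' a α := by rw [RingHom.id_apply, ← mul_smul]; rfl }
      map_add' β β' := LinearMap.ext fun α =>
        (congrArg (op · • u) (LinearMap.add_comp α β' β)).trans (add_smul _ _ _)
      map_smul' _ _ := rfl }
  map_add' u v := by ext; exact smul_add _ _ _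
  map_smul' a u := by
    ext β α
    change op (β ∘ₗ α) • a • u = op ((a.unop ∘ₗ β) ∘ₗ α) • u
    rw [← mul_smul]
    rfl

lemma homHomUnit_apply {U : Type u} [AddCommGroup U] [Module (Module.End R M)ᵐᵒᵖ U] (u : U)
    (β : N →ₗ[R] M) (α : M →ₗ[R] N) :
    homHomUnit (R := R) (M := M) U u β α = op (β ∘ₗ α) • u := rfl

lemma bijective_homHomUnit {n : ℕ} {x : Fin n → (N →ₗ[R] M)} {y : Fin n → (M →ₗ[R] N)}
    (h : ∑ i, x i ∘ₗ y i = LinearMap.id) (U : Type u) [AddCommGroup U]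
    [Module (Module.End R M)ᵐᵒᵖ U] : Function.Bijective (homHomUnit (R := R) (M := M) (N := N) U) := by
  have h' : ∑ i, op (x i ∘ₗ y i) = (1 : (Module.End R M)ᵐᵒᵖ) := by
    rw [← Finset.op_sum, h]
    rfl
  constructor
  · rw [injective_iff_map_eq_zero]
    intro u hu
    rw [← one_smul (Module.End R M)ᵐᵒᵖ u, ← h', Finset.sum_smul]
    exact Finset.sum_eq_zero fun i _ => by rw [← homHomUnit_apply, hu]; rfl
  · intro Φ
    refine ⟨∑ i, Φ (x i) (y i), LinearMap.ext fun β => LinearMap.ext fun α => ?_⟩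
    have key (i) : op (β ∘ₗ α) • Φ (x i) (y i) = Φ ((x i ∘ₗ y i) ∘ₗ β) α := by
      rw [← map_smul]
      exact LinearMap.congr_fun (map_smul Φ (op (y i ∘ₗ β)) (x i)).symm α
    rw [homHomUnit_apply, Finset.smul_sum]
    simp_rw [key]
    rw [← LinearMap.sum_apply, ← map_sum]
    congr 2
    ext m
    simpa using LinearMap.congr_fun h (β m)

lemma nonempty_endOp_equivalence {n k : ℕ} {x : Fin n → (N →ₗ[R] M)} {y : Fin n → (M →ₗ[R] N)}
    (h : ∑ i, x i ∘ₗ y i = LinearMap.id) {z : Fin k → (M →ₗ[R] N)} {w : Fin k → (N →ₗ[R] M)}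
    (h' : ∑ i, z i ∘ₗ w i = LinearMap.id) :
    Nonempty (ModuleCat.{u} (Module.End R M)ᵐᵒᵖ ≌ ModuleCat.{u} (Module.End R N)ᵐᵒᵖ) :=
  ⟨.mk (homFunctor M N) (homFunctor N M)
    (NatIso.ofComponents
      (fun U => (LinearEquiv.ofBijective _ (bijective_homHomUnit h U)).toModuleIso)
      fun f => by
        ext u
        exact LinearMap.ext fun β => LinearMap.ext fun α => (map_smul f.hom _ u).symm)
    (NatIso.ofComponents
      (fun U => (LinearEquiv.ofBijective _ (bijective_homHomUnit h' U)).toModuleIso)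
      fun f => by
        ext u
        exact LinearMap.ext fun β => LinearMap.ext fun α => (map_smul f.hom _ u).symm).symm⟩

end Morita

section NCCR

variable {R : Type u} [CommRing R] {M N : Type u} [AddCommGroup M] [Module R M] [AddCommGroup N]
  [Module R N]

lemma IsNonsingularOrder.globalDim_le_two {L : Type u} [Ring L] [Algebra R L]
    (h : IsNonsingularOrder R L) (hd : ringKrullDim R = 2) (m : Ideal R) [hm : m.IsMaximal] :
    globalDim (LocalizedModule m.primeCompl L) ≤ 2 := by
  have h1 := h.gldim m hm.isPrime
  have h2 := Ideal.height_le_ringKrullDim_of_ne_top hm.ne_top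
  rw [← IsLocalization.AtPrime.ringKrullDim_eq_height m (Localization.AtPrime m), ← h1, hd] at h2
  exact WithBot.coe_le_coe.1 h2

lemma IsNCCR.projective_hom [IsNoetherianRing R] [IsDomain R] [IsIntegrallyClosed R]
    (hd : ringKrullDim R = 2) (hM : IsNCCR R M) (hN : IsNCCR R N) :
    Module.Projective (Module.End R M)ᵐᵒᵖ (M →ₗ[R] N) := by
  obtain ⟨_, _, _, hM⟩ := hM
  obtain ⟨_, _, _, hN⟩ := hN
  exact projective_endOp_hom (hM.globalDim_le_two hd)

lemma IsNCCR.exists_sum_comp_eq_id [IsNoetherianRing R] [IsDomain R] [IsIntegrallyClosed R]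
    (hd : ringKrullDim R = 2) (hM : IsNCCR R M) (hN : IsNCCR R N) :
    ∃ (n : ℕ) (x : Fin n → (M →ₗ[R] N)) (y : Fin n → (N →ₗ[R] M)),
      ∑ i, x i ∘ₗ y i = LinearMap.id := by
  have := hM.projective_hom hd hN
  obtain ⟨_, _, _, -⟩ := hM
  obtain ⟨_, _, _, -⟩ := hN
  exact _root_.exists_sum_comp_eq_id

lemma inAdd_endOp {n : ℕ} {x : Fin n → (N →ₗ[R] M)} {y : Fin n → (M →ₗ[R] N)}
    (h : ∑ i, x i ∘ₗ y i = LinearMap.id) :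
    InAdd (Module.End R M)ᵐᵒᵖ (M →ₗ[R] N) (Module.End R M)ᵐᵒᵖ := by
  refine ⟨n, LinearMap.pi fun i => LinearMap.toSpanSingleton _ _ (y i),
    ∑ i, { toFun z := MulOpposite.op (x i ∘ₗ z i)
           map_add' z z' := congrArg MulOpposite.op (LinearMap.comp_add (z i) (z' i) (x i))
           map_smul' a z := rfl }, ?_⟩
  ext1
  simp only [LinearMap.comp_apply, LinearMap.sum_apply, LinearMap.id_apply]
  change ∑ i, MulOpposite.op (x i ∘ₗ ((1 : (Module.End R M)ᵐᵒᵖ) • y i)) = 1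
  simp_rw [one_smul]
  rw [← Finset.op_sum, h]
  rfl

end NCCR

/-- in dimension two all NCCRs are Morita equivalent via `Hom_R(M,N)`. -/
theorem stmt11 (R : Type u) [CommRing R] [IsNoetherianRing R] [IsDomain R]
    [IsIntegrallyClosed R]
    (hCM : IsCMRing R) (hEq : EquiCodimensional R) (hd : ringKrullDim R = 2)
    (w : Type u) [AddCommGroup w] [Module R w] (hw : IsGlobalCanonicalModule R w)
    (M N : Type u) [AddCommGroup M] [Module R M] [AddCommGroup N] [Module R N]
    (hM : IsNCCR R M) (hN : IsNCCR R N) :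
    Module.Finite (Module.End R M)ᵐᵒᵖ (M →ₗ[R] N) ∧
    Module.Projective (Module.End R M)ᵐᵒᵖ (M →ₗ[R] N) ∧
    InAdd (Module.End R M)ᵐᵒᵖ (M →ₗ[R] N) ((Module.End R M)ᵐᵒᵖ) ∧
    Nonempty (ModuleCat.{u} (Module.End R M)ᵐᵒᵖ ≌ ModuleCat.{u} (Module.End R N)ᵐᵒᵖ) := by
  obtain ⟨n, x, y, hxy⟩ := hN.exists_sum_comp_eq_id hd hM
  obtain ⟨k, z, v, hzv⟩ := hM.exists_sum_comp_eq_id hd hN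
  have hproj := hM.projective_hom hd hN
  obtain ⟨_, _, _, -⟩ := hM
  obtain ⟨_, _, _, -⟩ := hN
  exact ⟨finite_endOp_hom, hproj, inAdd_endOp hxy, nonempty_endOp_equivalence hxy hzv⟩
end
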